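/- Let H_1, …, H_T be simple graphs on a common finite vertex set V, let F be a nonempty finite set of unordered vertex pairs, and define the potential ρ = Σ_{t=1}^T ( c(H_t) − 1 ). If H_t ∪ F is connected for every t ∈ {1, …, T}, then there exists a single pair e ∈ F such that Σ_{t=1}^T ( c(H_t) − c(H_t ∪ {e}) ) ≥ ρ / |F|. (This is the per-step guarantee establishing that the greedy algorithm is an O(log T)-approximation for Minimum Common Spanning Subgraph.) -/

import Mathlib

open scoped Classical

noncomputable section

open SimpleGraph

/-- Joining two different components of a finite graph by an edge lowers the number of
components. -/
theorem card_connectedComponent_sup_edge_lt {V : Type*} [Finite V] (G : SimpleGraph V)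
    {e : Sym2 V} (he : ¬ (e.map G.connectedComponentMk).IsDiag) :
    Nat.card (G ⊔ SimpleGraph.fromEdgeSet {e}).ConnectedComponent <
      Nat.card G.ConnectedComponent := by
  induction e with | _ a b
  have hle : G ≤ G ⊔ SimpleGraph.fromEdgeSet {s(a, b)} := le_sup_left
  have hsurj := ConnectedComponent.surjective_map_ofLE hle
  refine lt_of_le_of_ne (ConnectedComponent.card_le_card_of_le hle) fun hcard => he ?_
  have hinj := ((Nat.bijective_iff_surjective_and_card _).2 ⟨hsurj, hcard.symm⟩).1
  rw [Sym2.map_mk, Sym2.mk_isDiag_iff]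
  by_cases hab : a = b
  · rw [hab]
  · apply hinj
    have hadj : (G ⊔ SimpleGraph.fromEdgeSet {s(a, b)}).Adj a b := by simp [hab]
    exact ConnectedComponent.sound hadj.reachable

/-- If adding the pairs in `F` makes a finite graph connected, then its number of components
minus one is at most the sum over `F` of the decreases caused by the single pairs. -/
theorem card_connectedComponent_sub_one_le_sum {V : Type*} [Finite V] (G : SimpleGraph V)
    (F : Finset (Sym2 V)) (hconn : (G ⊔ SimpleGraph.fromEdgeSet (↑F : Set (Sym2 V))).Connected) :
    Nat.card G.ConnectedComponent - 1 ≤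
      ∑ e ∈ F, (Nat.card G.ConnectedComponent -
        Nat.card (G ⊔ SimpleGraph.fromEdgeSet {e}).ConnectedComponent) := by
  let q : Sym2 V → Sym2 G.ConnectedComponent := Sym2.map G.connectedComponentMk
  let Q : SimpleGraph G.ConnectedComponent := SimpleGraph.fromEdgeSet (q '' ↑F)
  have hreach : ∀ {v w : V}, (G ⊔ SimpleGraph.fromEdgeSet (↑F : Set (Sym2 V))).Walk v w →
      Q.Reachable (G.connectedComponentMk v) (G.connectedComponentMk w) := by
    intro v w p
    induction p with
    | nil => exact Reachable.refl _
    | @cons u v w h p ih =>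
      refine Reachable.trans ?_ ih
      by_cases huv : G.connectedComponentMk u = G.connectedComponentMk v
      · rw [huv]
      · rcases h with h | h
        · exact absurd (ConnectedComponent.sound h.reachable) huv
        · refine Adj.reachable ((fromEdgeSet_adj _).2 ⟨⟨s(u, v), ?_, rfl⟩, huv⟩)
          exact ((fromEdgeSet_adj _).1 h).1
  have hQ : Q.Connected := by
    have := hconn.nonempty
    refine { preconnected := fun c d => ?_, nonempty := inferInstance }
    induction c using ConnectedComponent.ind with | _ v
    induction d using ConnectedComponent.ind with | _ w
    exact (hconn.preconnected v w).elim hreach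
  have hedges : Nat.card Q.edgeSet ≤ (F.filter fun e => ¬ (q e).IsDiag).card := by
    have hsub : Q.edgeSet ⊆ ((F.filter fun e => ¬ (q e).IsDiag).image q : Finset _) := by
      intro x hx
      rw [edgeSet_fromEdgeSet] at hx
      obtain ⟨⟨e, he, rfl⟩, hd⟩ := hx
      exact Finset.mem_coe.2 (Finset.mem_image_of_mem q (Finset.mem_filter.2 ⟨he, hd⟩))
    calc Nat.card Q.edgeSet ≤ _ := Nat.card_mono (Finset.finite_toSet _) hsub
      _ = _ := by rw [Nat.card_coe_set_eq, Set.ncard_coe_finset]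
      _ ≤ _ := Finset.card_image_le
  calc Nat.card G.ConnectedComponent - 1
      ≤ Nat.card Q.edgeSet := Nat.sub_le_of_le_add hQ.card_vert_le_card_edgeSet_add_one
    _ ≤ (F.filter fun e => ¬ (q e).IsDiag).card := hedges
    _ ≤ _ := by
      rw [Finset.card_filter]
      refine Finset.sum_le_sum fun e _ => ?_
      split_ifs with h
      · exact Nat.zero_le _
      · exact Nat.sub_pos_of_lt (card_connectedComponent_sup_edge_lt G h)

/-- let `H_1, …, H_T` be graphs on a common finite vertex set, `F` a nonempty
finite set of unordered pairs of (distinct) vertices, and `ρ = Σ_t (c(H_t) − 1)` where `c(·)`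
counts connected components.  If `H_t ∪ F` is connected for every `t`, then some single pair
`e ∈ F` satisfies `Σ_t (c(H_t) − c(H_t ∪ {e})) ≥ ρ / |F|`.  (This is the per-step guarantee
establishing that the greedy algorithm is an `O(log T)`-approximation for MCSS.) -/
theorem stmt16 {V : Type*} [Fintype V] {T : ℕ} (H : Fin T → SimpleGraph V)
    (F : Finset (Sym2 V)) (hFne : F.Nonempty) (hF : ∀ e ∈ F, ¬ e.IsDiag)
    (hconn : ∀ t, ((H t) ⊔ SimpleGraph.fromEdgeSet (↑F : Set (Sym2 V))).Connected) :
    ∃ e ∈ F,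
      ((∑ t, (Nat.card (H t).ConnectedComponent - 1) : ℕ) : ℚ) / (F.card : ℚ) ≤
        ((∑ t, (Nat.card (H t).ConnectedComponent -
          Nat.card ((H t) ⊔ SimpleGraph.fromEdgeSet {e}).ConnectedComponent) : ℕ) : ℚ) := by
  have hsum := Finset.sum_le_sum fun t (_ : t ∈ Finset.univ) =>
    card_connectedComponent_sub_one_le_sum (H t) F (hconn t)
  rw [Finset.sum_comm] at hsum
  have hpos : (0 : ℚ) < F.card := Nat.cast_pos.2 hFne.card_pos
  refine Finset.exists_le_of_sum_le hFne ?_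
  rw [Finset.sum_const, nsmul_eq_mul, mul_div_cancel₀ _ hpos.ne', ← Nat.cast_sum]
  exact Nat.cast_le.2 hsum

end
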